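/- Let G, H be countable groups, H hyperbolic, G ↷ (X,μ) a pmp action, and c : G × X → H a cocycle which is elementary, i.e. admits a Borel c-equivariant map φ : X → P_{≤2}(∂H) into probability measures on the Gromov boundary supported on at most 2 points. Then c is amenable. -/

import Mathlib

open MeasureTheory Filter Topology

/-- `ℓ¹` probability vectors on `H` (the space `P(H)`). -/
def IsProbVec {H : Type*} (p : H → ℝ) : Prop :=
  (∀ h, 0 ≤ p h) ∧ ∑' h, p h = 1

/-- The `ℓ¹` distance between two vectors. -/
noncomputable def l1dist {H : Type*} (p q : H → ℝ) : ℝ := ∑' h, |p h - q h|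

/-- The left translation action of `H` on `ℓ¹(H)`. -/
def lshift {H : Type*} [Group H] (h : H) (p : H → ℝ) : H → ℝ := fun k => p (h⁻¹ * k)

/-- A cocycle `c` for an action `σ` of `Γ` on `(X, μ)`, with values in a countable group `H`,
is *amenable* if there are Borel maps `φₙ : X → P(H)` with
`‖φₙ(gx) − c(g,x)·φₙ(x)‖₁ → 0` for every `g ∈ Γ` and a.e. `x ∈ X`. -/
def AmenableCocycle {Γ H X : Type*} [Group H] [MeasurableSpace X]
    (μ : Measure X) (σ : Γ → X → X) (c : Γ → X → H) : Prop :=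
  ∃ φ : ℕ → X → H → ℝ,
    (∀ n h, Measurable fun x => φ n x h) ∧
    (∀ n x, IsProbVec (φ n x)) ∧
    ∀ g : Γ, ∀ᵐ x ∂μ,
      Tendsto (fun n => l1dist (φ n (σ g x)) (lshift (c g x) (φ n x))) atTop (𝓝 0)

/-- A cocycle `c` for an action `σ` of `Γ` on `(X, μ)` is *essentially trivial* if there is a
Borel map `φ : X → F(H)` into finite nonempty subsets of `H` with `φ(gx) = c(g,x)·φ(x)`
for every `g ∈ Γ` and a.e. `x ∈ X`. -/
def EssTrivialCocycle {Γ H X : Type*} [Group H] [MeasurableSpace X]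
    (μ : Measure X) (σ : Γ → X → X) (c : Γ → X → H) : Prop :=
  ∃ φ : X → Finset H,
    (∀ F : Finset H, MeasurableSet {x | φ x = F}) ∧
    (∀ x, (φ x).Nonempty) ∧
    ∀ g : Γ, ∀ᵐ x ∂μ, (φ (σ g x) : Set H) = (fun h => c g x * h) '' (φ x : Set H)
/-- The word norm of `g` with respect to a (symmetrized) generating set `S`. -/
noncomputable def wordNorm {G : Type*} [Group G] (S : Set G) (g : G) : ℕ :=
  sInf {n | ∃ l : List G, l.length = n ∧ (∀ s ∈ l, s ∈ S ∨ s⁻¹ ∈ S) ∧ l.prod = g}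

/-- The Gromov product `(x⋅y)_e` with respect to the word metric of `S`. -/
noncomputable def gromovProd {G : Type*} [Group G] (S : Set G) (x y : G) : ℝ :=
  ((wordNorm S x : ℝ) + (wordNorm S y : ℝ) - (wordNorm S (x⁻¹ * y) : ℝ)) / 2

/-- A group is (Gromov) hyperbolic if it has a finite generating set whose word metric
satisfies the `δ`-hyperbolic four-point inequality for some `δ ≥ 0`. -/
def IsHyperbolicGroup (G : Type*) [Group G] : Prop :=
  ∃ S : Finset G, Subgroup.closure (S : Set G) = ⊤ ∧
    ∃ δ : ℝ, 0 ≤ δ ∧ ∀ x y z : G,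
      min (gromovProd (S : Set G) x z) (gromovProd (S : Set G) z y) - δ ≤
        gromovProd (S : Set G) x y
/-- A sequence in `H` converging to infinity in the Gromov sense (with respect to the word
metric of `S`). -/
def SeqToInfinity {H : Type*} [Group H] (S : Set H) (u : ℕ → H) : Prop :=
  ∀ C : ℝ, ∃ N : ℕ, ∀ i ≥ N, ∀ j ≥ N, C ≤ gromovProd S (u i) (u j)

/-- Two sequences converging to infinity define the same boundary point. -/
def BoundaryRel {H : Type*} [Group H] (S : Set H)
    (u v : {u : ℕ → H // SeqToInfinity S u}) : Prop :=
  ∀ C : ℝ, ∃ N : ℕ, ∀ i ≥ N, ∀ j ≥ N, C ≤ gromovProd S (u.1 i) (v.1 j)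

/-- The Gromov boundary `∂H` of `H` (with respect to `S`): equivalence classes of sequences
converging to infinity. -/
def GromovBoundary {H : Type*} [Group H] (S : Set H) : Type _ :=
  Quot (BoundaryRel S)

/-- The extension of the Gromov product to the boundary. -/
noncomputable def boundaryGromovProd {H : Type*} [Group H] (S : Set H)
    (p q : GromovBoundary S) : ENNReal :=
  ⨅ (u : {u : {u : ℕ → H // SeqToInfinity S u} // Quot.mk (BoundaryRel S) u = p})
    (v : {v : {v : ℕ → H // SeqToInfinity S v} // Quot.mk (BoundaryRel S) v = q}),
      Filter.liminf
        (fun ij : ℕ × ℕ => ENNReal.ofReal (gromovProd S (u.1.1 ij.1) (v.1.1 ij.2)))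
        Filter.atTop

/-- The topology on the Gromov boundary, generated by the "shadows"
`{q | (p⋅q) > t}`. -/
instance gromovBoundaryTopology {H : Type*} [Group H] (S : Set H) :
    TopologicalSpace (GromovBoundary S) :=
  TopologicalSpace.generateFrom
    {U | ∃ (p : GromovBoundary S) (t : ENNReal), U = {q | t < boundaryGromovProd S p q}}

/-- The Borel σ-algebra on the Gromov boundary. -/
instance gromovBoundaryMeasurable {H : Type*} [Group H] (S : Set H) :
    MeasurableSpace (GromovBoundary S) := borel (GromovBoundary S)

open scoped Pointwise

section WordMetric

variable {H : Type*} [Group H]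

theorem wordNorm_le_of_list {S : Set H} (l : List H) (hl : ∀ s ∈ l, s ∈ S ∨ s⁻¹ ∈ S) :
    wordNorm S l.prod ≤ l.length :=
  Nat.sInf_le ⟨l, rfl, hl, rfl⟩

theorem wordNorm_one (S : Set H) : wordNorm S (1 : H) = 0 := by
  simpa using wordNorm_le_of_list (S := S) [] (by simp)

theorem exists_list_length_eq_wordNorm {S : Set H} (hS : Subgroup.closure S = ⊤) (g : H) :
    ∃ l : List H, l.length = wordNorm S g ∧ (∀ s ∈ l, s ∈ S ∨ s⁻¹ ∈ S) ∧ l.prod = g := by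
  have hg : g ∈ (Subgroup.closure S).toSubmonoid := by simp [hS]
  rw [Subgroup.closure_toSubmonoid] at hg
  obtain ⟨l, hl, rfl⟩ := Submonoid.exists_list_of_mem_closure hg
  exact Nat.sInf_mem (s := {n | ∃ l' : List H, l'.length = n ∧
    (∀ s ∈ l', s ∈ S ∨ s⁻¹ ∈ S) ∧ l'.prod = l.prod}) ⟨_, l, rfl, hl, rfl⟩

theorem wordNorm_mul_le {S : Set H} (hS : Subgroup.closure S = ⊤) (g h : H) :
    wordNorm S (g * h) ≤ wordNorm S g + wordNorm S h := by
  obtain ⟨l, hl, hl', rfl⟩ := exists_list_length_eq_wordNorm hS g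
  obtain ⟨m, hm, hm', rfl⟩ := exists_list_length_eq_wordNorm hS h
  rw [← hl, ← hm, ← List.prod_append, ← List.length_append]
  refine wordNorm_le_of_list _ fun s hs => ?_
  rcases List.mem_append.1 hs with hs | hs
  exacts [hl' s hs, hm' s hs]

theorem wordNorm_inv_le {S : Set H} (hS : Subgroup.closure S = ⊤) (g : H) :
    wordNorm S g⁻¹ ≤ wordNorm S g := by
  obtain ⟨l, hl, hl', rfl⟩ := exists_list_length_eq_wordNorm hS g
  rw [← hl, List.prod_inv_reverse]
  refine (wordNorm_le_of_list _ fun s hs => ?_).trans (by simp)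
  have hs' : s⁻¹ ∈ l := by simpa using hs
  have := hl' _ hs'
  rw [inv_inv] at this
  exact this.symm

theorem wordNorm_inv {S : Set H} (hS : Subgroup.closure S = ⊤) (g : H) :
    wordNorm S g⁻¹ = wordNorm S g :=
  (wordNorm_inv_le hS g).antisymm (by simpa using wordNorm_inv_le hS g⁻¹)

theorem finite_setOf_wordNorm_le {S : Set H} (hfin : S.Finite) (hS : Subgroup.closure S = ⊤)
    (n : ℕ) : {g : H | wordNorm S g ≤ n}.Finite := by
  induction n with
  | zero =>
    refine (Set.finite_singleton (1 : H)).subset fun g hg => ?_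
    obtain ⟨l, hl, -, rfl⟩ := exists_list_length_eq_wordNorm hS g
    have hl0 : l = [] := List.length_eq_zero_iff.1 (hl.trans (Nat.le_zero.1 hg))
    simp [hl0]
  | succ n ih =>
    refine ((Set.finite_singleton (1 : H)).union ((hfin.union hfin.inv).mul ih)).subset
      fun g hg => ?_
    obtain ⟨l, hl, hl', rfl⟩ := exists_list_length_eq_wordNorm hS g
    rw [Set.mem_ofPred_eq, ← hl] at hg
    cases l with
    | nil => simp
    | cons s l =>
      right
      rw [List.prod_cons]
      refine Set.mul_mem_mul ?_ ?_
      · simpa using hl' s (by simp)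
      · exact (wordNorm_le_of_list l fun t ht => hl' t (by simp [ht])).trans
          (by simpa using hg)

/-- The word metric of `S`. -/
noncomputable def wordDist (S : Set H) (x y : H) : ℕ := wordNorm S (x⁻¹ * y)

theorem wordDist_self (S : Set H) (x : H) : wordDist S x x = 0 := by
  simp [wordDist, wordNorm_one]

theorem wordDist_comm {S : Set H} (hS : Subgroup.closure S = ⊤) (x y : H) :
    wordDist S x y = wordDist S y x := by
  rw [wordDist, ← wordNorm_inv hS]
  simp [wordDist]

theorem wordDist_triangle {S : Set H} (hS : Subgroup.closure S = ⊤) (x y z : H) :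
    wordDist S x z ≤ wordDist S x y + wordDist S y z := by
  simpa [wordDist, mul_assoc] using wordNorm_mul_le hS (x⁻¹ * y) (y⁻¹ * z)

theorem wordDist_mul_left (S : Set H) (h x y : H) :
    wordDist S (h * x) (h * y) = wordDist S x y := by
  simp [wordDist, mul_assoc]

theorem finite_setOf_wordDist_le {S : Set H} (hfin : S.Finite) (hS : Subgroup.closure S = ⊤)
    (x : H) (n : ℕ) : {g : H | wordDist S x g ≤ n}.Finite :=
  (finite_setOf_wordNorm_le hfin hS n).preimage (mul_right_injective x⁻¹).injOn

theorem ncard_setOf_wordDist_le (S : Set H) (x : H) (n : ℕ) :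
    {g : H | wordDist S x g ≤ n}.ncard = {g : H | wordNorm S g ≤ n}.ncard := by
  refine Set.ncard_congr (fun g _ => x⁻¹ * g) (fun g hg => hg)
    (fun a b _ _ hab => mul_left_cancel hab) fun b hb => ⟨x * b, ?_, by simp⟩
  simpa [wordDist] using hb

/-- Word metrics are geodesic. -/
theorem exists_wordDist_eq {S : Set H} (hS : Subgroup.closure S = ⊤) (x y : H) {m : ℕ}
    (hm : m ≤ wordDist S x y) :
    ∃ p, wordDist S x p = m ∧ m + wordDist S p y = wordDist S x y := by
  obtain ⟨l, hl, hl', hprod⟩ := exists_list_length_eq_wordNorm hS (x⁻¹ * y)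
  have hlen : l.length = wordDist S x y := hl
  have h1 : wordDist S x (x * (l.take m).prod) ≤ m := by
    rw [wordDist, inv_mul_cancel_left]
    exact (wordNorm_le_of_list _ fun s hs => hl' s (List.mem_of_mem_take hs)).trans
      (List.length_take_le _ _)
  have h2 : wordDist S (x * (l.take m).prod) y ≤ wordDist S x y - m := by
    have : (x * (l.take m).prod)⁻¹ * y = (l.drop m).prod := by
      rw [mul_inv_rev, mul_assoc, ← hprod, ← List.prod_take_mul_prod_drop l m,
        inv_mul_cancel_left]
    rw [wordDist, this, ← hlen, ← List.length_drop]
    exact wordNorm_le_of_list _ fun s hs => hl' s (List.mem_of_mem_drop hs)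
  have h3 := wordDist_triangle hS x (x * (l.take m).prod) y
  exact ⟨x * (l.take m).prod, by omega, by omega⟩

/-- The Gromov product `(x⋅y)_p` with respect to the word metric of `S`. -/
noncomputable def gromovProdAt (S : Set H) (p x y : H) : ℝ :=
  ((wordDist S p x : ℝ) + wordDist S p y - wordDist S x y) / 2

theorem gromovProd_inv_mul (S : Set H) (p x y : H) :
    gromovProd S (p⁻¹ * x) (p⁻¹ * y) = gromovProdAt S p x y := by
  simp [gromovProd, gromovProdAt, wordDist, mul_assoc]

theorem gromovProd_eq_gromovProdAt_one (S : Set H) (x y : H) :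
    gromovProd S x y = gromovProdAt S 1 x y := by
  simp [gromovProd, gromovProdAt, wordDist]

theorem gromovProdAt_mul_left (S : Set H) (h p x y : H) :
    gromovProdAt S (h * p) (h * x) (h * y) = gromovProdAt S p x y := by
  simp [gromovProdAt, wordDist_mul_left]

theorem gromovProd_comm {S : Set H} (hS : Subgroup.closure S = ⊤) (x y : H) :
    gromovProd S x y = gromovProd S y x := by
  simp only [gromovProd_eq_gromovProdAt_one, gromovProdAt, wordDist_comm hS x y]
  ring

theorem gromovProdAt_comm {S : Set H} (hS : Subgroup.closure S = ⊤) (p x y : H) :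
    gromovProdAt S p x y = gromovProdAt S p y x := by
  simp only [gromovProdAt, wordDist_comm hS x y]
  ring

/-- Moving the base point changes the Gromov product by at most the distance moved. -/
theorem gromovProdAt_le_add_wordDist {S : Set H} (hS : Subgroup.closure S = ⊤) (p q x y : H) :
    gromovProdAt S p x y ≤ gromovProdAt S q x y + wordDist S p q := by
  have h1 : (wordDist S p x : ℝ) ≤ wordDist S p q + wordDist S q x := by
    exact_mod_cast wordDist_triangle hS p q x
  have h2 : (wordDist S p y : ℝ) ≤ wordDist S p q + wordDist S q y := by
    exact_mod_cast wordDist_triangle hS p q y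
  simp only [gromovProdAt]
  linarith

/-- The Gromov product is at most the distance to either of the two points. -/
theorem gromovProdAt_le_left {S : Set H} (hS : Subgroup.closure S = ⊤) (p x y : H) :
    gromovProdAt S p x y ≤ wordDist S p x := by
  have h : (wordDist S p y : ℝ) ≤ wordDist S p x + wordDist S x y := by
    exact_mod_cast wordDist_triangle hS p x y
  simp only [gromovProdAt]
  linarith

theorem gromovProdAt_add_gromovProdAt {S : Set H} (hS : Subgroup.closure S = ⊤) (p x y : H) :
    gromovProdAt S p x y + gromovProdAt S x p y = wordDist S p x := by
  simp only [gromovProdAt, wordDist_comm hS x p]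
  ring

/-- The word metric of `S` satisfies the four-point inequality with constant `δ`. -/
def IsWordHyperbolic (S : Set H) (δ : ℝ) : Prop :=
  ∀ x y z : H, min (gromovProd S x z) (gromovProd S z y) - δ ≤ gromovProd S x y

theorem IsWordHyperbolic.le_gromovProd {S : Set H} {δ : ℝ} (h : IsWordHyperbolic S δ)
    {x y z : H} {t : ℝ} (h₁ : t ≤ gromovProd S x z) (h₂ : t ≤ gromovProd S z y) :
    t - δ ≤ gromovProd S x y :=
  (sub_le_sub_right (le_min h₁ h₂) δ).trans (h x y z)

theorem IsWordHyperbolic.le_gromovProdAt {S : Set H} {δ : ℝ} (h : IsWordHyperbolic S δ)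
    {p x y z : H} {t : ℝ} (h₁ : t ≤ gromovProdAt S p x z) (h₂ : t ≤ gromovProdAt S p z y) :
    t - δ ≤ gromovProdAt S p x y := by
  rw [← gromovProd_inv_mul] at *
  exact h.le_gromovProd h₁ h₂

end WordMetric

section Boundary

variable {H : Type*} [Group H] {S : Set H} {δ : ℝ}

theorem equivalence_boundaryRel (hS : Subgroup.closure S = ⊤) (hδ : IsWordHyperbolic S δ) :
    Equivalence (BoundaryRel S) where
  refl u := u.2
  symm {u v} h C := by
    obtain ⟨N, hN⟩ := h C
    exact ⟨N, fun i hi j hj => by rw [gromovProd_comm hS]; exact hN j hj i hi⟩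
  trans {u v w} h₁ h₂ C := by
    obtain ⟨N, hN⟩ := h₁ (C + δ)
    obtain ⟨M, hM⟩ := h₂ (C + δ)
    refine ⟨max N M, fun i hi j hj => ?_⟩
    have := hδ.le_gromovProd (hN i (le_of_max_le_left hi) (max N M) (le_max_left _ _))
      (hM (max N M) (le_max_right _ _) j (le_of_max_le_right hj))
    linarith

theorem boundaryRel_of_mk_eq (hS : Subgroup.closure S = ⊤) (hδ : IsWordHyperbolic S δ)
    {u v : {u : ℕ → H // SeqToInfinity S u}}
    (h : Quot.mk (BoundaryRel S) u = Quot.mk (BoundaryRel S) v) : BoundaryRel S u v :=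
  (equivalence_boundaryRel hS hδ).eqvGen_iff.1 (Quot.eqvGen_exact h)

theorem boundaryGromovProd_self (hS : Subgroup.closure S = ⊤) (hδ : IsWordHyperbolic S δ)
    (ξ : GromovBoundary S) : boundaryGromovProd S ξ ξ = ⊤ := by
  simp only [boundaryGromovProd, iInf_eq_top]
  rintro ⟨u, hu⟩ ⟨v, hv⟩
  refine Tendsto.liminf_eq (ENNReal.tendsto_ofReal_atTop.comp (tendsto_atTop.2 fun C => ?_))
  obtain ⟨N, hN⟩ := boundaryRel_of_mk_eq hS hδ (hu.trans hv.symm) C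
  filter_upwards [eventually_ge_atTop (N, N)] with ij hij
  exact hN _ hij.1 _ hij.2

theorem eventually_lt_gromovProd_of_lt_boundaryGromovProd
    {u v : {u : ℕ → H // SeqToInfinity S u}} {t : ℝ}
    (h : ENNReal.ofReal t < boundaryGromovProd S (Quot.mk _ u) (Quot.mk _ v)) :
    ∀ᶠ ij : ℕ × ℕ in atTop, t < gromovProd S (u.1 ij.1) (v.1 ij.2) := by
  have h' := h.trans_le (iInf₂_le (⟨u, rfl⟩ : {u' // Quot.mk (BoundaryRel S) u' = Quot.mk _ u})
    (⟨v, rfl⟩ : {v' // Quot.mk (BoundaryRel S) v' = Quot.mk _ v}))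
  filter_upwards [eventually_lt_of_lt_liminf h'] with ij hij
  exact (ENNReal.ofReal_lt_ofReal_iff'.1 hij).1

/-- The point `p` lies, up to an error `δ`, on geodesics from `y` to points near `ξ`. -/
def IsOnRay (S : Set H) (δ : ℝ) (y p : H) (ξ : GromovBoundary S) : Prop :=
  ∃ u : {u : ℕ → H // SeqToInfinity S u}, Quot.mk (BoundaryRel S) u = ξ ∧
    ∃ T : ℝ, ∀ w, (∀ᶠ i in atTop, T ≤ gromovProd S (u.1 i) w) → gromovProdAt S p y w ≤ δ

theorem IsOnRay.eventually_le (hS : Subgroup.closure S = ⊤) (hδ : IsWordHyperbolic S δ) {y p : H}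
    {v : {u : ℕ → H // SeqToInfinity S u}} (h : IsOnRay S δ y p (Quot.mk _ v)) :
    ∀ᶠ j in atTop, gromovProdAt S p y (v.1 j) ≤ δ := by
  obtain ⟨u, hu, T, hT⟩ := h
  obtain ⟨N, hN⟩ := boundaryRel_of_mk_eq hS hδ hu T
  filter_upwards [eventually_ge_atTop N] with j hj
  exact hT _ (eventually_atTop.2 ⟨N, fun i hi => hN i hi j hj⟩)

theorem isOpen_setOf_isOnRay (hS : Subgroup.closure S = ⊤) (hδ : IsWordHyperbolic S δ)
    (y p : H) : IsOpen {ξ : GromovBoundary S | IsOnRay S δ y p ξ} := by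
  rw [isOpen_iff_forall_mem_open]
  rintro ξ ⟨u, rfl, T, hT⟩
  refine ⟨{η | ENNReal.ofReal (T + δ) < boundaryGromovProd S (Quot.mk _ u) η}, ?_,
    TopologicalSpace.isOpen_generateFrom_of_mem ⟨_, _, rfl⟩, ?_⟩
  · rintro ⟨v⟩ hv
    refine ⟨v, rfl, T + δ, fun w hw => hT w ?_⟩
    obtain ⟨⟨N, M⟩, hNM⟩ :=
      eventually_atTop.1 (eventually_lt_gromovProd_of_lt_boundaryGromovProd hv)
    filter_upwards [eventually_ge_atTop N] with i hi
    obtain ⟨j, hjw, hjM⟩ := (hw.and (eventually_ge_atTop M)).exists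
    have := hδ.le_gromovProd (hNM (i, j) ⟨hi, hjM⟩).le hjw
    linarith
  · exact ENNReal.ofReal_lt_top.trans_eq (boundaryGromovProd_self hS hδ _).symm

theorem exists_isOnRay (hS : Subgroup.closure S = ⊤) (hδ : IsWordHyperbolic S δ)
    (y : H) (ξ : GromovBoundary S) (l : ℕ) :
    ∃ p, wordDist S y p = l ∧ IsOnRay S δ y p ξ := by
  obtain ⟨u⟩ := ξ
  obtain ⟨N, hN⟩ := u.2 (max (l + δ + wordDist S 1 y) (l + wordDist S 1 y))
  have hdist : l ≤ wordDist S y (u.1 N) := by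
    have h1 := (le_max_right _ _).trans (hN N le_rfl N le_rfl)
    rw [gromovProd_eq_gromovProdAt_one] at h1
    have h2 := gromovProdAt_le_add_wordDist hS 1 y (u.1 N) (u.1 N)
    have h3 := gromovProdAt_le_left hS y (u.1 N) (u.1 N)
    exact_mod_cast (by linarith : (l : ℝ) ≤ wordDist S y (u.1 N))
  obtain ⟨p, hp, hpu⟩ := exists_wordDist_eq hS y (u.1 N) hdist
  refine ⟨p, hp, u, rfl, l + δ + wordDist S 1 y, fun w hw => ?_⟩
  obtain ⟨i, hiw, hiN⟩ := (hw.and (eventually_ge_atTop N)).exists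
  have h1 := hδ.le_gromovProd ((le_max_left _ _).trans (hN N le_rfl i hiN)) hiw
  rw [gromovProd_eq_gromovProdAt_one] at h1
  have h2 := gromovProdAt_le_add_wordDist hS 1 y (u.1 N) w
  have h3 : gromovProdAt S y p (u.1 N) = l := by
    have : (l : ℝ) + wordDist S p (u.1 N) = wordDist S y (u.1 N) := by exact_mod_cast hpu
    simp only [gromovProdAt, hp, ← this]
    ring
  have h4 := hδ.le_gromovProdAt h3.ge (by linarith : (l : ℝ) ≤ gromovProdAt S y (u.1 N) w)
  have h5 := gromovProdAt_add_gromovProdAt hS y p w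
  rw [hp] at h5
  linarith

/-- The thickened shadow of `x` at distance about `l` in the direction `ξ`. -/
def raySet (S : Set H) (δ : ℝ) (x : H) (ξ : GromovBoundary S) (l k : ℕ) : Set H :=
  {p | ∃ y, wordDist S x y ≤ k ∧ wordDist S y p = l ∧ IsOnRay S δ y p ξ}

theorem raySet_nonempty (hS : Subgroup.closure S = ⊤) (hδ : IsWordHyperbolic S δ)
    (x : H) (ξ : GromovBoundary S) (l k : ℕ) : (raySet S δ x ξ l k).Nonempty := by
  obtain ⟨p, hp, hp'⟩ := exists_isOnRay hS hδ x ξ l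
  exact ⟨p, x, by simp [wordDist_self], hp, hp'⟩

theorem raySet_subset_ball (hS : Subgroup.closure S = ⊤)
    (x : H) (ξ : GromovBoundary S) (l k : ℕ) :
    raySet S δ x ξ l k ⊆ {p | wordDist S x p ≤ l + k} := by
  rintro p ⟨y, hxy, hyp, -⟩
  have := wordDist_triangle hS x y p
  simp only [Set.mem_ofPred_eq]
  omega

theorem finite_raySet (hfin : S.Finite) (hS : Subgroup.closure S = ⊤)
    (x : H) (ξ : GromovBoundary S) (l k : ℕ) : (raySet S δ x ξ l k).Finite :=
  (finite_setOf_wordDist_le hfin hS x _).subset (raySet_subset_ball hS x ξ l k)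

theorem raySet_subset_raySet (hS : Subgroup.closure S = ⊤) (x y : H) (ξ : GromovBoundary S)
    (l : ℕ) {k k' : ℕ} (h : wordDist S y x + k ≤ k') :
    raySet S δ x ξ l k ⊆ raySet S δ y ξ l k' := by
  rintro p ⟨z, hxz, hzp⟩
  exact ⟨z, ((wordDist_triangle hS y x z).trans (by omega)), hzp⟩

theorem measurableSet_setOf_mem_raySet [Countable H] (hS : Subgroup.closure S = ⊤)
    (hδ : IsWordHyperbolic S δ) (x p : H) (l k : ℕ) :
    MeasurableSet {ξ : GromovBoundary S | p ∈ raySet S δ x ξ l k} := by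
  have : {ξ : GromovBoundary S | p ∈ raySet S δ x ξ l k} =
      ⋃ y, {ξ | wordDist S x y ≤ k ∧ wordDist S y p = l ∧ IsOnRay S δ y p ξ} := by
    ext ξ
    simp [raySet]
  rw [this]
  refine MeasurableSet.iUnion fun y => ?_
  have hopen : MeasurableSet {ξ : GromovBoundary S | IsOnRay S δ y p ξ} :=
    MeasurableSpace.measurableSet_generateFrom (isOpen_setOf_isOnRay hS hδ y p)
  exact (MeasurableSet.const _).inter ((MeasurableSet.const _).inter hopen)

/-- The points of a thickened shadow at a given distance from `x` form a set of diameter at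
most `6 * δ`. -/
theorem wordDist_le_of_mem_raySet (hS : Subgroup.closure S = ⊤) (hδ : IsWordHyperbolic S δ)
    {x : H} {ξ : GromovBoundary S} {l k : ℕ} (hlk : k + 2 * δ < l) {p q : H}
    (hp : p ∈ raySet S δ x ξ l k) (hq : q ∈ raySet S δ x ξ l k)
    (hpq : wordDist S x p = wordDist S x q) : (wordDist S p q : ℝ) ≤ 6 * δ := by
  obtain ⟨v⟩ := ξ
  have key : ∀ r ∈ raySet S δ x (Quot.mk _ v) l k,
      ∀ᶠ j in atTop, wordDist S x r - 2 * δ ≤ gromovProdAt S x r (v.1 j) := by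
    rintro r ⟨y, hxy, hyr, hr⟩
    filter_upwards [hr.eventually_le hS hδ] with j hj
    by_contra! hcon
    have h1 := gromovProdAt_add_gromovProdAt hS x r (v.1 j)
    have hxy' : (wordDist S x y : ℝ) ≤ k := by exact_mod_cast hxy
    have hyr' : (wordDist S y r : ℝ) = l := by exact_mod_cast hyr
    have h2 : (wordDist S y r : ℝ) ≤ wordDist S y x + wordDist S x r := by
      exact_mod_cast wordDist_triangle hS y x r
    have h3 : (l : ℝ) - k ≤ gromovProdAt S r y x := by
      simp only [gromovProdAt, wordDist_comm hS r y, wordDist_comm hS r x]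
      rw [wordDist_comm hS y x] at *
      linarith
    have h4 : 2 * δ < min (gromovProdAt S r y x) (gromovProdAt S r x (v.1 j)) :=
      lt_min (by linarith) (by linarith)
    have h5 := hδ.le_gromovProdAt (min_le_left _ _) (min_le_right (gromovProdAt S r y x)
      (gromovProdAt S r x (v.1 j)))
    linarith
  obtain ⟨j, hjp, hjq⟩ := ((key p hp).and (key q hq)).exists
  rw [gromovProdAt_comm hS] at hjq
  have h := hδ.le_gromovProdAt (hjp.trans_eq' (by rw [hpq])) hjq
  simp only [gromovProdAt, hpq] at h
  linarith

theorem ncard_raySet_le (hfin : S.Finite) (hS : Subgroup.closure S = ⊤)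
    (hδ : IsWordHyperbolic S δ) (x : H) (ξ : GromovBoundary S) {l k : ℕ}
    (hlk : k + 2 * δ < l) :
    (raySet S δ x ξ l k).ncard ≤ (l + k + 1) * {g : H | wordNorm S g ≤ ⌊6 * δ⌋₊}.ncard := by
  classical
  rw [Set.ncard_eq_toFinset_card _ (finite_raySet hfin hS x ξ l k)]
  rw [mul_comm, ← Finset.card_range (l + k + 1)]
  refine Finset.card_le_mul_card_image_of_maps_to (f := wordDist S x) (fun p hp => ?_) _
    fun m _ => ?_
  · have := raySet_subset_ball hS x ξ l k ((Set.Finite.mem_toFinset _).1 hp)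
    simp only [Set.mem_ofPred_eq] at this
    rw [Finset.mem_range]
    omega
  · rcases Finset.eq_empty_or_nonempty {p ∈ (finite_raySet hfin hS x ξ l k).toFinset |
      wordDist S x p = m} with h | ⟨p, hp⟩
    · rw [h]
      exact Nat.zero_le _
    · rw [← ncard_setOf_wordDist_le S p, ← Set.ncard_coe_finset]
      refine Set.ncard_le_ncard (fun q hq => ?_) (finite_setOf_wordDist_le hfin hS p _)
      simp only [Finset.coe_filter, Set.Finite.mem_toFinset, Set.mem_ofPred_eq,
        Finset.mem_filter] at hp hq
      exact Nat.le_floor (wordDist_le_of_mem_raySet hS hδ hlk hp.1 hq.1 (hp.2.trans hq.2.symm))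

end Boundary

section FinitelySupported

variable {H : Type*}

theorem l1dist_eq_sum {p q : H → ℝ} (F : Finset H) (hp : ∀ h ∉ F, p h = 0)
    (hq : ∀ h ∉ F, q h = 0) : l1dist p q = ∑ h ∈ F, |p h - q h| :=
  tsum_eq_sum fun h hh => by simp [hp h hh, hq h hh]

theorem l1dist_nonneg (p q : H → ℝ) : 0 ≤ l1dist p q := tsum_nonneg fun _ => abs_nonneg _

theorem l1dist_comm (p q : H → ℝ) : l1dist p q = l1dist q p := by
  simp only [l1dist, abs_sub_comm]

theorem l1dist_triangle {p q r : H → ℝ} (F : Finset H) (hp : ∀ h ∉ F, p h = 0)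
    (hq : ∀ h ∉ F, q h = 0) (hr : ∀ h ∉ F, r h = 0) :
    l1dist p r ≤ l1dist p q + l1dist q r := by
  rw [l1dist_eq_sum F hp hr, l1dist_eq_sum F hp hq, l1dist_eq_sum F hq hr,
    ← Finset.sum_add_distrib]
  exact Finset.sum_le_sum fun h _ => abs_sub_le _ _ _

/-- The uniform probability vector on a finite nonempty set. -/
noncomputable def uniformVec (A : Set H) : H → ℝ := A.indicator fun _ => (A.ncard : ℝ)⁻¹

theorem uniformVec_of_notMem {A : Set H} {h : H} (hh : h ∉ A) : uniformVec A h = 0 :=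
  Set.indicator_of_notMem hh _

theorem uniformVec_nonneg (A : Set H) (h : H) : 0 ≤ uniformVec A h :=
  Set.indicator_nonneg (fun _ _ => by positivity) h

theorem sum_uniformVec {A : Set H} {F : Finset H} (hA : A.Nonempty) (hAF : A ⊆ F) :
    ∑ h ∈ F, uniformVec A h = 1 := by
  classical
  lift A to Finset H using F.finite_toSet.subset hAF
  have hA' : (A.card : ℝ) ≠ 0 := by
    simpa [Finset.nonempty_iff_ne_empty] using hA
  simp only [uniformVec]
  rw [Finset.sum_indicator_subset _ (by exact_mod_cast hAF)]
  simp [hA']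

theorem l1dist_uniformVec_of_subset {A E : Set H} (hA : A.Nonempty) (hE : E.Finite)
    (hAE : A ⊆ E) :
    l1dist (uniformVec A) (uniformVec E) = 2 * (1 - (A.ncard : ℝ) / E.ncard) := by
  classical
  lift A to Finset H using hE.subset hAE
  lift E to Finset H using hE
  have hAE' : A ⊆ E := by exact_mod_cast hAE
  have hA' : 0 < (A.card : ℝ) := by
    exact_mod_cast Finset.card_pos.2 (by exact_mod_cast hA)
  have hle : (A.card : ℝ) ≤ E.card := by exact_mod_cast Finset.card_le_card hAE'
  have hE' : 0 < (E.card : ℝ) := hA'.trans_le hle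
  rw [l1dist_eq_sum E (fun h hh => uniformVec_of_notMem fun h' => hh (hAE h'))
    (fun h hh => uniformVec_of_notMem (by simpa using hh)), ← Finset.sum_sdiff hAE']
  have h1 : ∀ h ∈ E \ A, |uniformVec (A : Set H) h - uniformVec (E : Set H) h| =
      (E.card : ℝ)⁻¹ := by
    intro h hh
    simp only [Finset.mem_sdiff] at hh
    simp [uniformVec, hh.1, hh.2]
  have h2 : ∀ h ∈ A, |uniformVec (A : Set H) h - uniformVec (E : Set H) h| =
      (A.card : ℝ)⁻¹ - (E.card : ℝ)⁻¹ := by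
    intro h hh
    have : (E.card : ℝ)⁻¹ ≤ (A.card : ℝ)⁻¹ := inv_anti₀ hA' hle
    simp [uniformVec, hh, hAE' hh, abs_of_nonneg (sub_nonneg.2 this)]
  rw [Finset.sum_congr rfl h1, Finset.sum_congr rfl h2, Finset.sum_const, Finset.sum_const,
    nsmul_eq_mul, nsmul_eq_mul, Finset.cast_card_sdiff hAE', Set.ncard_coe_finset,
    Set.ncard_coe_finset]
  field_simp
  ring

theorem l1dist_uniformVec_le {A B C E : Set H} (hE : E.Finite) (hC : C.Nonempty) (hCA : C ⊆ A)
    (hCB : C ⊆ B) (hAE : A ⊆ E) (hBE : B ⊆ E) :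
    l1dist (uniformVec A) (uniformVec B) ≤ 4 * (Real.log E.ncard - Real.log C.ncard) := by
  have key : ∀ D : Set H, C ⊆ D → D ⊆ E →
      l1dist (uniformVec D) (uniformVec E) ≤ 2 * (Real.log E.ncard - Real.log C.ncard) := by
    intro D hCD hDE
    rw [l1dist_uniformVec_of_subset (hC.mono hCD) hE hDE]
    have hC0 : 0 < (C.ncard : ℝ) := by
      exact_mod_cast (Set.ncard_pos (hE.subset (hCD.trans hDE))).2 hC
    have hCD' : (C.ncard : ℝ) ≤ D.ncard := by
      exact_mod_cast Set.ncard_le_ncard hCD (hE.subset hDE)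
    have hDE' : (D.ncard : ℝ) ≤ E.ncard := by exact_mod_cast Set.ncard_le_ncard hDE hE
    have hD0 := hC0.trans_le hCD'
    have hE0 := hD0.trans_le hDE'
    have h1 := Real.add_one_le_exp (Real.log (D.ncard / E.ncard))
    have h2 : 0 < (D.ncard : ℝ) / E.ncard := by positivity
    rw [Real.exp_log h2, Real.log_div (by positivity) (by positivity)] at h1
    have h3 := Real.log_le_log hC0 hCD'
    linarith
  have h1 := key A hCA hAE
  have h2 := key B hCB hBE
  rw [l1dist_comm] at h2
  have hout : ∀ D ⊆ E, ∀ h ∉ hE.toFinset, uniformVec D h = 0 := fun D hD h hh =>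
    uniformVec_of_notMem fun h' => hh (by simpa using hD h')
  have := l1dist_triangle hE.toFinset (hout A hAE) (hout E le_rfl) (hout B hBE)
  linarith

theorem sum_range_sub_shift_le {L : ℕ → ℝ} (hL : Monotone L) (hL0 : ∀ k, 0 ≤ L k) (M N D : ℕ) :
    ∑ k ∈ Finset.range N, (L (M + k + D) - L (M + k)) ≤ D * L (M + N + D) := by
  induction D with
  | zero => simp
  | succ D ih =>
    have h1 : ∑ k ∈ Finset.range N, (L (M + k + (D + 1)) - L (M + k + D)) =
        L (M + N + D) - L (M + D) := by
      have := Finset.sum_range_sub (fun k => L (M + k + D)) N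
      simpa [add_assoc, add_comm, add_left_comm] using this
    have h2 : ∑ k ∈ Finset.range N, (L (M + k + (D + 1)) - L (M + k)) =
        (L (M + N + D) - L (M + D)) +
          ∑ k ∈ Finset.range N, (L (M + k + D) - L (M + k)) := by
      rw [← h1, ← Finset.sum_add_distrib]
      exact Finset.sum_congr rfl fun k _ => by ring
    have h3 : L (M + N + D) ≤ L (M + N + (D + 1)) := hL (by omega)
    have h4 := hL0 (M + D)
    have h5 : (D : ℝ) * L (M + N + D) ≤ D * L (M + N + (D + 1)) := by gcongr
    rw [h2]
    push_cast
    linarith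

end FinitelySupported

section RayVec

variable {H : Type*} [Group H] {S : Set H} {δ : ℝ}

/-- Averages of uniform probability vectors on thickened shadows. -/
noncomputable def rayVec (S : Set H) (δ : ℝ) (n : ℕ) (x : H) (ξ : GromovBoundary S) (h : H) : ℝ :=
  ((n + 1 : ℕ) : ℝ)⁻¹ * ∑ k ∈ Finset.range (n + 1),
    uniformVec (raySet S δ x ξ (3 * (n + 1)) (n + 1 + k)) h

theorem rayVec_nonneg (n : ℕ) (x : H) (ξ : GromovBoundary S) (h : H) :
    0 ≤ rayVec S δ n x ξ h :=
  mul_nonneg (by positivity) (Finset.sum_nonneg fun _ _ => uniformVec_nonneg _ _)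

theorem raySet_subset_of_le (hS : Subgroup.closure S = ⊤) {n k : ℕ} (hk : k < n + 1) (x : H)
    (ξ : GromovBoundary S) {F : Finset H} (hF : ∀ p, wordDist S x p ≤ 5 * (n + 1) → p ∈ F) :
    raySet S δ x ξ (3 * (n + 1)) (n + 1 + k) ⊆ F := fun p hp =>
  hF p ((raySet_subset_ball hS x ξ _ _ hp : wordDist S x p ≤ _).trans (by omega))

theorem rayVec_eq_zero (hS : Subgroup.closure S = ⊤) {n : ℕ} {x : H} (ξ : GromovBoundary S)
    {F : Finset H} (hF : ∀ p, wordDist S x p ≤ 5 * (n + 1) → p ∈ F) {h : H} (hh : h ∉ F) :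
    rayVec S δ n x ξ h = 0 := by
  rw [rayVec, Finset.sum_eq_zero, mul_zero]
  exact fun k hk => uniformVec_of_notMem fun h' =>
    hh (raySet_subset_of_le hS (Finset.mem_range.1 hk) x ξ hF h')

theorem sum_rayVec (hS : Subgroup.closure S = ⊤) (hδ : IsWordHyperbolic S δ) {n : ℕ} {x : H}
    (ξ : GromovBoundary S) {F : Finset H} (hF : ∀ p, wordDist S x p ≤ 5 * (n + 1) → p ∈ F) :
    ∑ h ∈ F, rayVec S δ n x ξ h = 1 := by
  simp only [rayVec]
  rw [← Finset.mul_sum, Finset.sum_comm, Finset.sum_congr rfl fun k hk =>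
    sum_uniformVec (raySet_nonempty hS hδ x ξ _ _)
      (raySet_subset_of_le hS (Finset.mem_range.1 hk) x ξ hF)]
  simp only [Finset.sum_const, Finset.card_range, nsmul_eq_mul, mul_one]
  exact inv_mul_cancel₀ (by positivity)

theorem l1dist_rayVec_le (hfin : S.Finite) (hS : Subgroup.closure S = ⊤)
    (hδ : IsWordHyperbolic S δ) (hδ0 : 0 ≤ δ) {n : ℕ} (x y : H) (ξ : GromovBoundary S)
    (hn : wordDist S x y + 2 * δ < n) :
    l1dist (rayVec S δ n x ξ) (rayVec S δ n y ξ) ≤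
      ((n + 1 : ℕ) : ℝ)⁻¹ * (8 * wordDist S x y * Real.log
        (7 * {g : H | wordNorm S g ≤ ⌊6 * δ⌋₊}.ncard * (n + 1 : ℕ))) := by
  classical
  set d := wordDist S x y with hd
  set B := {g : H | wordNorm S g ≤ ⌊6 * δ⌋₊}.ncard
  have hdn : d < n := by exact_mod_cast (by linarith : (d : ℝ) < n)
  set A : ℕ → Set H := fun k => raySet S δ x ξ (3 * (n + 1)) k
  set A' : ℕ → Set H := fun k => raySet S δ y ξ (3 * (n + 1)) k
  have hAmono : Monotone A := fun k k' hk =>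
    raySet_subset_raySet hS x x ξ _ (by simpa [wordDist_self] using hk)
  have hAfin : ∀ k, (A k).Finite := fun k => finite_raySet hfin hS x ξ _ k
  have hAne : ∀ k, (A k).Nonempty := fun k => raySet_nonempty hS hδ x ξ _ k
  set L : ℕ → ℝ := fun k => Real.log (A k).ncard
  have hA1 : ∀ k, 1 ≤ (A k).ncard := fun k => (Set.ncard_pos (hAfin k)).2 (hAne k)
  have hLmono : Monotone L := fun k k' hk => Real.log_le_log (by exact_mod_cast hA1 k)
    (by exact_mod_cast Set.ncard_le_ncard (hAmono hk) (hAfin k'))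
  have hL0 : ∀ k, 0 ≤ L k := fun k => Real.log_nonneg (by exact_mod_cast hA1 k)
  set F := (finite_setOf_wordDist_le hfin hS x (5 * (n + 1))).toFinset ∪
    (finite_setOf_wordDist_le hfin hS y (5 * (n + 1))).toFinset
  have hFx : ∀ p, wordDist S x p ≤ 5 * (n + 1) → p ∈ F := fun p hp => by simp [F, hp]
  have hFy : ∀ p, wordDist S y p ≤ 5 * (n + 1) → p ∈ F := fun p hp => by simp [F, hp]
  have havg : l1dist (rayVec S δ n x ξ) (rayVec S δ n y ξ) ≤ ((n + 1 : ℕ) : ℝ)⁻¹ *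
      ∑ k ∈ Finset.range (n + 1),
        l1dist (uniformVec (A (n + 1 + k))) (uniformVec (A' (n + 1 + k))) := by
    rw [l1dist_eq_sum F (fun h => rayVec_eq_zero hS ξ hFx) (fun h => rayVec_eq_zero hS ξ hFy)]
    have hk : ∀ k ∈ Finset.range (n + 1),
        l1dist (uniformVec (A (n + 1 + k))) (uniformVec (A' (n + 1 + k))) =
        ∑ h ∈ F, |uniformVec (A (n + 1 + k)) h - uniformVec (A' (n + 1 + k)) h| := by
      intro k hk
      have hk' := Finset.mem_range.1 hk
      exact l1dist_eq_sum F
        (fun h hh => uniformVec_of_notMem fun h' => hh (raySet_subset_of_le hS hk' x ξ hFx h'))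
        (fun h hh => uniformVec_of_notMem fun h' => hh (raySet_subset_of_le hS hk' y ξ hFy h'))
    rw [Finset.sum_congr rfl hk, Finset.sum_comm, Finset.mul_sum]
    refine Finset.sum_le_sum fun h _ => ?_
    rw [rayVec, rayVec, ← mul_sub, ← Finset.sum_sub_distrib, abs_mul,
      abs_of_nonneg (by positivity)]
    gcongr
    exact Finset.abs_sum_le_sum_abs _ _
  refine havg.trans ?_
  gcongr
  have hterm : ∀ k ∈ Finset.range (n + 1),
      l1dist (uniformVec (A (n + 1 + k))) (uniformVec (A' (n + 1 + k))) ≤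
        4 * (L (n + 1 - d + k + 2 * d) - L (n + 1 - d + k)) := by
    intro k _
    refine l1dist_uniformVec_le (hAfin _) (hAne _) (hAmono (by omega)) ?_ (hAmono (by omega)) ?_
    · exact raySet_subset_raySet hS x y ξ _ (by rw [wordDist_comm hS y x]; omega)
    · exact raySet_subset_raySet hS y x ξ _ (by omega)
  have hsum := sum_range_sub_shift_le hLmono hL0 (n + 1 - d) (n + 1) (2 * d)
  have hcard : (A (n + 1 - d + (n + 1) + 2 * d)).ncard ≤ 7 * B * (n + 1) := by
    have hlt : ((n + 1 - d + (n + 1) + 2 * d : ℕ) : ℝ) + 2 * δ < (3 * (n + 1) : ℕ) := by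
      rw [show n + 1 - d + (n + 1) + 2 * d = 2 * (n + 1) + d by omega]
      push_cast
      linarith
    refine (ncard_raySet_le hfin hS hδ x ξ hlt).trans ?_
    calc _ ≤ 7 * (n + 1) * B := Nat.mul_le_mul_right _ (by omega)
      _ = 7 * B * (n + 1) := by ring
  have hlog : L (n + 1 - d + (n + 1) + 2 * d) ≤ Real.log (7 * B * (n + 1 : ℕ)) :=
    Real.log_le_log (by exact_mod_cast hA1 _) (by exact_mod_cast hcard)
  calc _ ≤ ∑ k ∈ Finset.range (n + 1),
        4 * (L (n + 1 - d + k + 2 * d) - L (n + 1 - d + k)) := Finset.sum_le_sum hterm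
    _ ≤ 4 * ((2 * d : ℕ) * L (n + 1 - d + (n + 1) + 2 * d)) := by
      rw [← Finset.mul_sum]
      gcongr
    _ ≤ 4 * ((2 * d : ℕ) * Real.log (7 * B * (n + 1 : ℕ))) := by gcongr
    _ = _ := by push_cast; ring

/-- The vectors `rayVec S δ n x ξ` and `rayVec S δ n y ξ` are asymptotically equal, uniformly in
`ξ`. -/
theorem exists_l1dist_rayVec_le (hfin : S.Finite) (hS : Subgroup.closure S = ⊤)
    (hδ : IsWordHyperbolic S δ) (hδ0 : 0 ≤ δ) (x y : H) :
    ∃ ε : ℕ → ℝ, Tendsto ε atTop (𝓝 0) ∧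
      ∀ᶠ n in atTop, ∀ ξ, l1dist (rayVec S δ n x ξ) (rayVec S δ n y ξ) ≤ ε n := by
  set B := {g : H | wordNorm S g ≤ ⌊6 * δ⌋₊}.ncard
  have hB0 : 0 < (7 * B : ℝ) := by
    have : 0 < B := (Set.ncard_pos (finite_setOf_wordNorm_le hfin hS _)).2
      ⟨1, by simp [wordNorm_one]⟩
    positivity
  refine ⟨fun n => ((n + 1 : ℕ) : ℝ)⁻¹ * (8 * wordDist S x y * Real.log (7 * B * (n + 1 : ℕ))),
    ?_, ?_⟩
  · have hcast : Tendsto (fun n : ℕ => (7 * B * (n + 1 : ℕ) : ℝ)) atTop atTop :=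
      (tendsto_natCast_atTop_atTop.comp (tendsto_add_atTop_nat 1)).const_mul_atTop hB0
    have h := (Real.isLittleO_log_id_atTop.tendsto_div_nhds_zero.comp hcast).const_mul
      (8 * wordDist S x y * (7 * B : ℝ))
    rw [mul_zero] at h
    refine h.congr fun n => ?_
    have hn : ((n + 1 : ℕ) : ℝ) ≠ 0 := by positivity
    have hB' : (B : ℝ) ≠ 0 := fun h0 => by simp [h0] at hB0
    simp only [Function.comp_apply, id]
    field_simp
  · filter_upwards [tendsto_natCast_atTop_atTop.eventually_gt_atTop
      ((wordDist S x y : ℝ) + 2 * δ)] with n hn ξ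
    exact l1dist_rayVec_le hfin hS hδ hδ0 x y ξ hn

theorem measurable_rayVec [Countable H] (hfin : S.Finite) (hS : Subgroup.closure S = ⊤)
    (hδ : IsWordHyperbolic S δ) (n : ℕ) (x h : H) : Measurable fun ξ => rayVec S δ n x ξ h := by
  classical
  refine (Finset.measurable_sum _ fun k _ => ?_).const_mul _
  set l := 3 * (n + 1)
  set m := n + 1 + k
  have hcard : Measurable fun ξ : GromovBoundary S => ((raySet S δ x ξ l m).ncard : ℝ) := by
    set F := (finite_setOf_wordDist_le hfin hS x (l + m)).toFinset
    have : (fun ξ : GromovBoundary S => ((raySet S δ x ξ l m).ncard : ℝ)) = fun ξ =>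
        ∑ p ∈ F, if p ∈ raySet S δ x ξ l m then (1 : ℝ) else 0 := by
      ext ξ
      rw [Finset.sum_boole, ← Set.ncard_coe_finset]
      congr 2
      ext p
      have := @raySet_subset_ball _ _ S δ hS x ξ l m p
      simpa [F] using this
    rw [this]
    exact Finset.measurable_sum _ fun p _ =>
      Measurable.ite (measurableSet_setOf_mem_raySet hS hδ x p l m) measurable_const
        measurable_const
  have : (fun ξ : GromovBoundary S => uniformVec (raySet S δ x ξ l m) h) = fun ξ =>
      if h ∈ raySet S δ x ξ l m then ((raySet S δ x ξ l m).ncard : ℝ)⁻¹ else 0 := by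
    ext ξ
    simp [uniformVec, Set.indicator_apply]
  rw [this]
  exact Measurable.ite (measurableSet_setOf_mem_raySet hS hδ x h l m) hcard.inv measurable_const

theorem integrable_rayVec [Countable H] (hfin : S.Finite) (hS : Subgroup.closure S = ⊤)
    (hδ : IsWordHyperbolic S δ) (n : ℕ) (x h : H) (ν : Measure (GromovBoundary S))
    [IsFiniteMeasure ν] : Integrable (fun ξ => rayVec S δ n x ξ h) ν := by
  classical
  refine Integrable.of_bound (measurable_rayVec hfin hS hδ n x h).aestronglyMeasurable 1
    (Eventually.of_forall fun ξ => ?_)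
  rw [Real.norm_of_nonneg (rayVec_nonneg n x ξ h)]
  set F := (finite_setOf_wordDist_le hfin hS x (5 * (n + 1))).toFinset
  have hF : ∀ p, wordDist S x p ≤ 5 * (n + 1) → p ∈ insert h F := fun p hp => by simp [F, hp]
  rw [← sum_rayVec hS hδ ξ hF]
  exact Finset.single_le_sum (fun p _ => rayVec_nonneg n x ξ p) (Finset.mem_insert_self h F)

section Equivariance

variable {act : H → GromovBoundary S → GromovBoundary S}
  {hSeq : ∀ (h : H) (u : ℕ → H), SeqToInfinity S u → SeqToInfinity S fun n => h * u n}

theorem IsOnRay.mul_left (hS : Subgroup.closure S = ⊤)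
    (h_act : ∀ (h : H) (u : ℕ → H) (hu : SeqToInfinity S u),
      act h (Quot.mk (BoundaryRel S) ⟨u, hu⟩) =
        Quot.mk (BoundaryRel S) ⟨fun n => h * u n, hSeq h u hu⟩)
    {y p : H} {ξ : GromovBoundary S} (hξ : IsOnRay S δ y p ξ) (h : H) :
    IsOnRay S δ (h * y) (h * p) (act h ξ) := by
  obtain ⟨⟨u, hu⟩, rfl, T, hT⟩ := hξ
  refine ⟨⟨_, hSeq h u hu⟩, (h_act h u hu).symm, T + wordDist S h 1, fun w hw => ?_⟩
  rw [← mul_inv_cancel_left h w, gromovProdAt_mul_left]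
  refine hT _ (hw.mono fun i hi => ?_)
  have h1 := gromovProdAt_le_add_wordDist hS 1 h (h * u i) w
  rw [wordDist_comm hS] at h1
  have h2 : gromovProdAt S h (h * u i) w = gromovProd S (u i) (h⁻¹ * w) := by
    rw [← gromovProd_inv_mul, inv_mul_cancel_left]
  rw [gromovProd_eq_gromovProdAt_one] at hi
  linarith

theorem act_inv_act
    (h_act : ∀ (h : H) (u : ℕ → H) (hu : SeqToInfinity S u),
      act h (Quot.mk (BoundaryRel S) ⟨u, hu⟩) =
        Quot.mk (BoundaryRel S) ⟨fun n => h * u n, hSeq h u hu⟩)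
    (h : H) (ξ : GromovBoundary S) : act h⁻¹ (act h ξ) = ξ := by
  obtain ⟨u, hu⟩ := ξ
  rw [h_act, h_act]
  exact congrArg _ (Subtype.ext (funext fun n => inv_mul_cancel_left h (u n)))

theorem mul_mem_raySet (hS : Subgroup.closure S = ⊤)
    (h_act : ∀ (h : H) (u : ℕ → H) (hu : SeqToInfinity S u),
      act h (Quot.mk (BoundaryRel S) ⟨u, hu⟩) =
        Quot.mk (BoundaryRel S) ⟨fun n => h * u n, hSeq h u hu⟩)
    {x p : H} {ξ : GromovBoundary S} {l k : ℕ} (hp : p ∈ raySet S δ x ξ l k) (h : H) :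
    h * p ∈ raySet S δ (h * x) (act h ξ) l k := by
  obtain ⟨y, hxy, hyp, hy⟩ := hp
  exact ⟨h * y, by rwa [wordDist_mul_left], by rwa [wordDist_mul_left], hy.mul_left hS h_act h⟩

theorem raySet_mul_left (hS : Subgroup.closure S = ⊤)
    (h_act : ∀ (h : H) (u : ℕ → H) (hu : SeqToInfinity S u),
      act h (Quot.mk (BoundaryRel S) ⟨u, hu⟩) =
        Quot.mk (BoundaryRel S) ⟨fun n => h * u n, hSeq h u hu⟩)
    (h x : H) (ξ : GromovBoundary S) (l k : ℕ) :
    raySet S δ (h * x) (act h ξ) l k = (h * ·) '' raySet S δ x ξ l k := by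
  refine Set.Subset.antisymm (fun p hp => ⟨h⁻¹ * p, ?_, mul_inv_cancel_left h p⟩) ?_
  · simpa [act_inv_act h_act] using mul_mem_raySet hS h_act hp h⁻¹
  · rintro _ ⟨p, hp, rfl⟩
    exact mul_mem_raySet hS h_act hp h

theorem rayVec_mul_left (hS : Subgroup.closure S = ⊤)
    (h_act : ∀ (h : H) (u : ℕ → H) (hu : SeqToInfinity S u),
      act h (Quot.mk (BoundaryRel S) ⟨u, hu⟩) =
        Quot.mk (BoundaryRel S) ⟨fun n => h * u n, hSeq h u hu⟩)
    (n : ℕ) (h x : H) (ξ : GromovBoundary S) (p : H) :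
    rayVec S δ n (h * x) (act h ξ) (h * p) = rayVec S δ n x ξ p := by
  classical
  simp only [rayVec, raySet_mul_left hS h_act]
  congr 1
  refine Finset.sum_congr rfl fun k _ => ?_
  rw [uniformVec, Set.ncard_image_of_injective _ (mul_right_injective h)]
  simp [uniformVec, Set.indicator_apply]

end Equivariance

end RayVec

/-- Let `H` be a hyperbolic group (with finite generating set `S` whose word
metric is `δ`-hyperbolic), `G ↷ (X,μ)` a pmp action and `c : G × X → H` an *elementary*
cocycle, i.e. one admitting a Borel `c`-equivariant map `φ : X → P_{≤2}(∂H)` into probability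
measures on the Gromov boundary supported on at most two points. Then `c` is amenable.
(The action of `H` on `∂H` is by translation of representative sequences; it is supplied here
as the map `act`, together with its defining property and its Borel measurability, all of
which are automatic.) -/
theorem elementary_cocycle_is_amenable
    {G H X : Type*} [Group G] [Countable G] [Group H] [Countable H]
    [MeasurableSpace H] [MeasurableSingletonClass H]
    [MeasurableSpace X] (μ : Measure X) [IsProbabilityMeasure μ]
    [MulAction G X] (hsmul_meas : ∀ g : G, Measurable fun x : X => g • x)
    [SMulInvariantMeasure G X μ]
    (c : G → X → H) (hc_meas : ∀ g : G, Measurable (c g))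
    (hc_cocycle : ∀ g₁ g₂ : G, ∀ᵐ x ∂μ, c (g₁ * g₂) x = c g₁ (g₂ • x) * c g₂ x)
    -- `H` is hyperbolic, with `δ`-hyperbolic word metric coming from the
    -- finite generating set `S`:
    (S : Finset H) (h_gen : Subgroup.closure (S : Set H) = ⊤)
    (δ : ℝ) (hδ : 0 ≤ δ)
    (h_hyp : ∀ x y z : H,
      min (gromovProd (S : Set H) x z) (gromovProd (S : Set H) z y) - δ ≤
        gromovProd (S : Set H) x y)
    -- the translation action of `H` on its Gromov boundary:
    (act : H → GromovBoundary (S : Set H) → GromovBoundary (S : Set H))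
    (hSeq : ∀ (h : H) (u : ℕ → H), SeqToInfinity (S : Set H) u →
      SeqToInfinity (S : Set H) fun n => h * u n)
    (h_act : ∀ (h : H) (u : ℕ → H) (hu : SeqToInfinity (S : Set H) u),
      act h (Quot.mk (BoundaryRel (S : Set H)) ⟨u, hu⟩) =
        Quot.mk (BoundaryRel (S : Set H)) ⟨fun n => h * u n, hSeq h u hu⟩)
    (h_act_meas : ∀ h : H, Measurable (act h))
    -- `c` is elementary: a Borel `c`-equivariant assignment of probability measures on `∂H`
    -- supported on at most 2 points:
    (φ : X → Measure (GromovBoundary (S : Set H)))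
    (hφ_prob : ∀ x, IsProbabilityMeasure (φ x))
    (hφ_supp : ∀ x, ∃ a b : GromovBoundary (S : Set H), φ x {a, b} = 1)
    (hφ_meas : ∀ A : Set (GromovBoundary (S : Set H)), MeasurableSet A →
      Measurable fun x => φ x A)
    (hφ_equiv : ∀ g : G, ∀ᵐ x ∂μ, φ (g • x) = (φ x).map (act (c g x))) :
    AmenableCocycle μ (fun (g : G) (x : X) => g • x) c := by
  classical
  have hfin : (S : Set H).Finite := S.finite_toSet
  have hyp : IsWordHyperbolic (S : Set H) δ := h_hyp
  have hball : ∀ (x : H) (n : ℕ), ∃ F : Finset H,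
      ∀ p, wordDist (S : Set H) x p ≤ 5 * (n + 1) → p ∈ F :=
    fun x n => ⟨(finite_setOf_wordDist_le hfin h_gen x (5 * (n + 1))).toFinset,
      fun p hp => by simpa using hp⟩
  have hint : ∀ (n : ℕ) (y h : H) (x : X),
      Integrable (fun ξ => rayVec (S : Set H) δ n y ξ h) (φ x) := fun n y h x =>
    integrable_rayVec hfin h_gen hyp n y h (φ x)
  refine ⟨fun n x h => ∫ ξ, rayVec (S : Set H) δ n 1 ξ h ∂(φ x), fun n h => ?_,
    fun n x => ⟨fun h => ?_, ?_⟩, fun g => ?_⟩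
  · let κ : ProbabilityTheory.Kernel X (GromovBoundary (S : Set H)) :=
      ⟨φ, Measure.measurable_of_measurable_coe φ hφ_meas⟩
    exact ((measurable_rayVec hfin h_gen hyp n 1 h).stronglyMeasurable.integral_kernel
      (κ := κ)).measurable
  · exact integral_nonneg fun ξ => rayVec_nonneg n 1 ξ h
  · obtain ⟨F, hF⟩ := hball 1 n
    rw [tsum_eq_sum (s := F) fun h hh => by simp [rayVec_eq_zero h_gen _ hF hh],
      ← integral_finsetSum _ fun h _ => hint n 1 h x]
    simp [sum_rayVec h_gen hyp _ hF]
  · filter_upwards [hφ_equiv g] with x hx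
    set a := c g x
    obtain ⟨ε, hε, hle⟩ := exists_l1dist_rayVec_le hfin h_gen hyp hδ 1 a
    refine squeeze_zero' (Eventually.of_forall fun n => l1dist_nonneg _ _) ?_ hε
    filter_upwards [hle] with n hn
    obtain ⟨F₁, hF₁⟩ := hball 1 n
    obtain ⟨F₂, hF₂⟩ := hball a n
    have hF₁' : ∀ p, wordDist (S : Set H) 1 p ≤ 5 * (n + 1) → p ∈ F₁ ∪ F₂ := fun p hp =>
      Finset.mem_union_left _ (hF₁ p hp)
    have hF₂' : ∀ p, wordDist (S : Set H) a p ≤ 5 * (n + 1) → p ∈ F₁ ∪ F₂ := fun p hp =>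
      Finset.mem_union_right _ (hF₂ p hp)
    have hint' : ∀ y h : H,
        Integrable (fun ξ => rayVec (S : Set H) δ n y (act a ξ) h) (φ x) := fun y h =>
      (integrable_rayVec hfin h_gen hyp n y h ((φ x).map (act a))).comp_measurable (h_act_meas a)
    have h1 : (fun h => ∫ ξ, rayVec (S : Set H) δ n 1 ξ h ∂(φ (g • x))) =
        fun h => ∫ ξ, rayVec (S : Set H) δ n 1 (act a ξ) h ∂(φ x) := by
      ext h
      rw [hx, integral_map (h_act_meas a).aemeasurable
        (measurable_rayVec hfin h_gen hyp n 1 h).aestronglyMeasurable]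
    have h2 : lshift a (fun h => ∫ ξ, rayVec (S : Set H) δ n 1 ξ h ∂(φ x)) =
        fun h => ∫ ξ, rayVec (S : Set H) δ n a (act a ξ) h ∂(φ x) := by
      ext h
      simp only [lshift]
      refine integral_congr_ae (Eventually.of_forall fun ξ => ?_)
      simpa using (rayVec_mul_left (δ := δ) h_gen h_act n a 1 ξ (a⁻¹ * h)).symm
    simp only [h1, h2]
    rw [l1dist_eq_sum (F₁ ∪ F₂) (fun h hh => by simp [rayVec_eq_zero h_gen _ hF₁' hh])
      (fun h hh => by simp [rayVec_eq_zero h_gen _ hF₂' hh])]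
    calc ∑ h ∈ F₁ ∪ F₂, |∫ ξ, rayVec (S : Set H) δ n 1 (act a ξ) h ∂(φ x) -
            ∫ ξ, rayVec (S : Set H) δ n a (act a ξ) h ∂(φ x)|
        ≤ ∑ h ∈ F₁ ∪ F₂, ∫ ξ, |rayVec (S : Set H) δ n 1 (act a ξ) h -
            rayVec (S : Set H) δ n a (act a ξ) h| ∂(φ x) := by
          refine Finset.sum_le_sum fun h _ => ?_
          rw [← integral_sub (hint' 1 h) (hint' a h)]
          exact abs_integral_le_integral_abs
      _ = ∫ ξ, ∑ h ∈ F₁ ∪ F₂, |rayVec (S : Set H) δ n 1 (act a ξ) h -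
            rayVec (S : Set H) δ n a (act a ξ) h| ∂(φ x) :=
          (integral_finsetSum _ fun h _ => ((hint' 1 h).sub (hint' a h)).abs).symm
      _ ≤ ∫ _, ε n ∂(φ x) := by
          refine integral_mono (integrable_finsetSum _ fun h _ =>
            ((hint' 1 h).sub (hint' a h)).abs) (integrable_const _) fun ξ => ?_
          refine le_trans (le_of_eq ?_) (hn (act a ξ))
          exact (l1dist_eq_sum (F₁ ∪ F₂) (fun h => rayVec_eq_zero h_gen _ hF₁')
            (fun h => rayVec_eq_zero h_gen _ hF₂')).symm
      _ = ε n := by simp
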